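/- Let λ > 0, N a positive integer, c > 0, and y > 0. Then (1/2πi)∫_{c−i∞}^{c+i∞} y^s ((e^{λs}−1)/(λs))^N ds/s equals 1 if y ≥ 1, lies in [0,1] if e^{−λN} ≤ y < 1, and equals 0 if 0 < y < e^{−λN}. -/

import Mathlib

open Complex MeasureTheory

/-- The smoothed Perron kernel integral
`(1/2πi)∫_{c-i∞}^{c+i∞} y^s ((e^{λs}-1)/(λs))^N ds/s`, written as an integral over the
vertical line `Re s = c` (so `ds = i dt` and `1/(2πi) ds = 1/(2π) dt`). -/
noncomputable def perronKernelInt (lam : ℝ) (N : ℕ) (c y : ℝ) : ℂ :=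
  (1 / (2 * Real.pi)) *
    ∫ t : ℝ, (y : ℂ) ^ ((c : ℂ) + t * Complex.I) *
      ((Complex.exp ((lam : ℂ) * ((c : ℂ) + t * Complex.I)) - 1) /
        ((lam : ℂ) * ((c : ℂ) + t * Complex.I))) ^ N / ((c : ℂ) + t * Complex.I)

open Set in
/-- The `n`-fold average over `[0, lam]` of the translates of the indicator of `(-∞, 0]`. -/
noncomputable def smoothedStep (lam : ℝ) : ℕ → ℝ → ℝ
  | 0 => indicator (Iic 0) 1
  | n + 1 => fun v => lam⁻¹ * ∫ u in (0 : ℝ)..lam, smoothedStep lam n (v - u)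

theorem continuous_average_of_bounded (lam : ℝ) {f : ℝ → ℝ} (hf : Measurable f)
    (h0 : ∀ v, 0 ≤ f v) (h1 : ∀ v, f v ≤ 1) :
    Continuous fun v => lam⁻¹ * ∫ u in (0 : ℝ)..lam, f (v - u) := by
  have hint : ∀ a b, IntervalIntegrable f volume a b := fun a b =>
    (intervalIntegrable_const (c := (1 : ℝ))).mono_fun hf.aestronglyMeasurable
      (.of_forall fun v => by simpa [abs_of_nonneg (h0 v)] using h1 v)
  have hc := intervalIntegral.continuous_primitive hint 0
  have heq : ∀ v, ∫ u in (0 : ℝ)..lam, f (v - u) =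
      (∫ x in (0 : ℝ)..v, f x) - ∫ x in (0 : ℝ)..(v - lam), f x := by
    intro v
    rw [intervalIntegral.integral_comp_sub_left, sub_zero,
      intervalIntegral.integral_interval_sub_left (hint _ _) (hint _ _)]
  simp_rw [heq]
  exact continuous_const.mul (hc.sub (hc.comp (continuous_id.sub continuous_const)))

theorem smoothedStep_measurable_and_mem_Icc {lam : ℝ} (hlam : 0 < lam) (n : ℕ) :
    Measurable (smoothedStep lam n) ∧ ∀ v, smoothedStep lam n v ∈ Set.Icc 0 1 := by
  induction n with
  | zero =>
    refine ⟨measurable_one.indicator measurableSet_Iic, fun v => ?_⟩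
    by_cases hv : v ≤ 0 <;> simp [smoothedStep, Set.indicator, hv]
  | succ n ih =>
    obtain ⟨hm, hb⟩ := ih
    refine ⟨(continuous_average_of_bounded lam hm (fun v => (hb v).1)
      fun v => (hb v).2).measurable, fun v => ⟨?_, ?_⟩⟩
    · exact mul_nonneg (inv_nonneg.2 hlam.le)
        (intervalIntegral.integral_nonneg hlam.le fun u _ => (hb _).1)
    · have h := intervalIntegral.norm_integral_le_of_norm_le_const (a := 0) (b := lam) (C := 1)
        (f := fun u => smoothedStep lam n (v - u))
        fun u _ => by simpa [abs_of_nonneg (hb _).1] using (hb (v - u)).2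
      rw [sub_zero, one_mul, abs_of_pos hlam, Real.norm_eq_abs] at h
      change lam⁻¹ * _ ≤ 1
      rw [inv_mul_le_iff₀ hlam, mul_one]
      exact (le_abs_self _).trans h

theorem measurable_smoothedStep {lam : ℝ} (hlam : 0 < lam) (n : ℕ) :
    Measurable (smoothedStep lam n) :=
  (smoothedStep_measurable_and_mem_Icc hlam n).1

theorem smoothedStep_mem_Icc {lam : ℝ} (hlam : 0 < lam) (n : ℕ) (v : ℝ) :
    smoothedStep lam n v ∈ Set.Icc 0 1 :=
  (smoothedStep_measurable_and_mem_Icc hlam n).2 v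

theorem continuous_smoothedStep_succ {lam : ℝ} (hlam : 0 < lam) (n : ℕ) :
    Continuous (smoothedStep lam (n + 1)) :=
  continuous_average_of_bounded lam (measurable_smoothedStep hlam n)
    (fun v => (smoothedStep_mem_Icc hlam n v).1) fun v => (smoothedStep_mem_Icc hlam n v).2

theorem smoothedStep_of_nonpos {lam : ℝ} (hlam : 0 < lam) (n : ℕ) {v : ℝ} (hv : v ≤ 0) :
    smoothedStep lam n v = 1 := by
  induction n generalizing v with
  | zero => simp [smoothedStep, hv]
  | succ n ih =>
    have h : ∫ u in (0 : ℝ)..lam, smoothedStep lam n (v - u) = ∫ _ in (0 : ℝ)..lam, (1 : ℝ) := by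
      refine intervalIntegral.integral_congr fun u hu => ih ?_
      rw [Set.uIcc_of_le hlam.le] at hu
      linarith [hu.1]
    simp [smoothedStep, h, hlam.ne']

theorem smoothedStep_of_lt {lam : ℝ} (hlam : 0 < lam) (n : ℕ) {v : ℝ} (hv : lam * n < v) :
    smoothedStep lam n v = 0 := by
  induction n generalizing v with
  | zero => simpa [smoothedStep] using hv
  | succ n ih =>
    have h : ∫ u in (0 : ℝ)..lam, smoothedStep lam n (v - u) = ∫ _ in (0 : ℝ)..lam, (0 : ℝ) := by
      refine intervalIntegral.integral_congr fun u hu => ih ?_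
      rw [Set.uIcc_of_le hlam.le] at hu
      push_cast at hv
      linarith [hu.2]
    simp [smoothedStep, h]

open Set in
theorem hasMellin_smoothedStep_log {lam : ℝ} (hlam : 0 < lam) (n : ℕ) {s : ℂ} (hs : 0 < s.re) :
    HasMellin (fun t => (smoothedStep lam n (Real.log t) : ℂ)) s
      (((exp (lam * s) - 1) / (lam * s)) ^ n / s) := by
  have hs0 : s ≠ 0 := fun h => by simp [h] at hs
  have hl0 : (lam : ℂ) ≠ 0 := by exact_mod_cast hlam.ne'
  induction n with
  | zero =>
    have h := hasMellin_one_Ioc hs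
    have heq : EqOn (fun t : ℝ => (t : ℂ) ^ (s - 1) • indicator (Ioc 0 1) (fun _ => (1 : ℂ)) t)
        (fun t : ℝ => (t : ℂ) ^ (s - 1) • (smoothedStep lam 0 (Real.log t) : ℂ)) (Ioi 0) := by
      intro t ht
      have : Real.log t ≤ 0 ↔ t ≤ 1 := Real.log_nonpos_iff (le_of_lt ht)
      have ht' : 0 < t := ht
      by_cases h1 : t ≤ 1 <;> simp [smoothedStep, indicator, this, h1, ht']
    refine ⟨h.1.congr_fun heq measurableSet_Ioi, ?_⟩
    rw [pow_zero, ← h.2]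
    exact (setIntegral_congr_fun measurableSet_Ioi heq).symm
  | succ n ih =>
    set F : ℝ → ℝ → ℂ := fun t u =>
      (t : ℂ) ^ (s - 1) * (smoothedStep lam n (Real.log t - u) : ℂ) with hF
    set R := Real.exp (lam * (n + 1)) with hR
    have hR0 : 0 < R := Real.exp_pos _
    have hdom : Integrable (indicator (Ioc 0 R) fun t : ℝ => t ^ (s.re - 1))
        (volume.restrict (Ioi 0)) := by
      rw [integrable_indicator_iff measurableSet_Ioc]
      refine IntegrableOn.mono_measure ?_ Measure.restrict_le_self
      exact (intervalIntegrable_iff_integrableOn_Ioc_of_le hR0.le).1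
        (intervalIntegral.intervalIntegrable_rpow' (by linarith))
    have hFint : Integrable (Function.uncurry F)
        ((volume.restrict (Ioi 0)).prod (volume.restrict (Ioc 0 lam))) := by
      refine Integrable.mono' (hdom.comp_fst _) ?_ ?_
      · have := measurable_smoothedStep hlam n
        refine Measurable.aestronglyMeasurable ?_
        simp only [hF, Function.uncurry_def]
        fun_prop
      · rw [Measure.prod_restrict]
        filter_upwards [ae_restrict_mem (measurableSet_Ioi.prod measurableSet_Ioc)] with p hp
        obtain ⟨t, u⟩ := p
        obtain ⟨ht, hu⟩ := hp
        have ht : 0 < t := ht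
        have hu : 0 < u ∧ u ≤ lam := hu
        have hb := smoothedStep_mem_Icc hlam n (Real.log t - u)
        simp only [Function.uncurry_apply_pair, hF, norm_mul, norm_cpow_eq_rpow_re_of_pos ht,
          norm_real, Real.norm_eq_abs, abs_of_nonneg hb.1, sub_re, one_re]
        by_cases htR : t ≤ R
        · rw [indicator_of_mem (show t ∈ Ioc 0 R from ⟨ht, htR⟩)]
          exact mul_le_of_le_one_right (Real.rpow_nonneg ht.le _) hb.2
        · have : lam * (n + 1) < Real.log t := by
            rw [Real.lt_log_iff_exp_lt ht]
            exact not_le.1 htR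
          rw [smoothedStep_of_lt hlam n (by linarith), mul_zero]
          exact indicator_nonneg (fun x hx => Real.rpow_nonneg hx.1.le _) _
    have hstep : ∀ t : ℝ, (t : ℂ) ^ (s - 1) • (smoothedStep lam (n + 1) (Real.log t) : ℂ) =
        (lam : ℂ)⁻¹ * ∫ u in Ioc 0 lam, F t u := by
      intro t
      simp only [hF, smoothedStep, integral_const_mul, smul_eq_mul, ofReal_mul, ofReal_inv,
        intervalIntegral.integral_of_le hlam.le, integral_complex_ofReal]
      ring
    have hscale : ∀ u, ∫ t in Ioi (0 : ℝ), F t u =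
        exp (s * u) * (((exp (lam * s) - 1) / (lam * s)) ^ n / s) := by
      intro u
      have h := mellin_comp_mul_right (fun t => (smoothedStep lam n (Real.log t) : ℂ)) s
        (Real.exp_pos (-u))
      rw [ih.2] at h
      rw [show exp (s * u) = (Real.exp (-u) : ℂ) ^ (-s) by
        rw [cpow_def_of_ne_zero (by exact_mod_cast (Real.exp_pos _).ne'), ← ofReal_log
          (Real.exp_pos _).le, Real.log_exp]
        push_cast; ring_nf]
      rw [← smul_eq_mul, ← h]
      refine setIntegral_congr_fun measurableSet_Ioi fun t ht => ?_
      simp only [hF, smul_eq_mul]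
      rw [Real.log_mul (ne_of_gt ht) (Real.exp_pos _).ne', Real.log_exp, sub_eq_add_neg (Real.log t)]
    refine ⟨?_, ?_⟩
    · rw [MellinConvergent, IntegrableOn]
      simp_rw [hstep]
      exact hFint.integral_prod_left.const_mul _
    · rw [mellin]
      simp_rw [hstep]
      rw [integral_const_mul, integral_integral_swap hFint]
      simp_rw [hscale]
      rw [integral_mul_const, ← intervalIntegral.integral_of_le hlam.le,
        integral_exp_mul_complex hs0]
      rw [ofReal_zero, mul_zero, exp_zero, mul_comm s lam, pow_succ]
      field_simp

theorem integrable_smoothed_kernel {lam : ℝ} (hlam : 0 < lam) (n : ℕ) {c : ℝ} (hc : 0 < c) :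
    Integrable fun t : ℝ => ((exp (lam * (c + t * I)) - 1) / (lam * (c + t * I))) ^ (n + 1) /
      ((c : ℂ) + t * I) := by
  have hre : ∀ t : ℝ, ((c : ℂ) + t * I).re = c := by simp
  have hs : ∀ t : ℝ, (c : ℂ) + t * I ≠ 0 := fun t h => by
    have := hre t
    rw [h, zero_re] at this
    exact hc.ne this
  have hl0 : (lam : ℂ) ≠ 0 := by exact_mod_cast hlam.ne'
  set A := Real.exp (lam * c) + 1 with hA
  have hA0 : 0 < A := by positivity
  set m := min (c ^ 2) 1 with hm
  have hm0 : 0 < m := lt_min (by positivity) one_pos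
  refine Integrable.mono' (integrable_inv_one_add_sq.const_mul
    ((A / (lam * c)) ^ n * (A / lam) * m⁻¹)) ?_ (.of_forall fun t => ?_)
  · refine Continuous.aestronglyMeasurable ?_
    refine Continuous.div ?_ (by fun_prop) hs
    refine Continuous.pow (Continuous.div (by fun_prop) (by fun_prop) fun t => ?_) _
    exact mul_ne_zero hl0 (hs t)
  · have hcs : c ≤ ‖(c : ℂ) + t * I‖ := by
      simpa [abs_of_pos hc] using abs_re_le_norm ((c : ℂ) + t * I)
    have hsq : m * (1 + t ^ 2) ≤ ‖(c : ℂ) + t * I‖ ^ 2 := by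
      rw [← normSq_eq_norm_sq, normSq_add_mul_I]
      nlinarith [min_le_left (c ^ 2) 1, min_le_right (c ^ 2) 1, sq_nonneg t]
    have hnum : ‖exp (lam * (c + t * I)) - 1‖ ≤ A := by
      refine (norm_sub_le _ _).trans ?_
      simp [norm_exp, hA]
    set r := ‖(c : ℂ) + t * I‖
    have hr : 0 < r := hc.trans_le hcs
    rw [norm_div, norm_pow, norm_div, norm_mul, norm_real, Real.norm_of_nonneg hlam.le]
    calc (‖exp (lam * (c + t * I)) - 1‖ / (lam * r)) ^ (n + 1) / r
        ≤ (A / (lam * r)) ^ (n + 1) / r := by gcongr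
      _ = (A / (lam * r)) ^ n * (A / lam) * (r ^ 2)⁻¹ := by
        rw [pow_succ]
        field_simp
      _ ≤ (A / (lam * c)) ^ n * (A / lam) * (m * (1 + t ^ 2))⁻¹ := by gcongr
      _ = _ := by rw [mul_inv]; ring

theorem perronKernelInt_eq_smoothedStep {lam : ℝ} (hlam : 0 < lam) {N : ℕ} (hN : 0 < N) {c : ℝ}
    (hc : 0 < c) {y : ℝ} (hy : 0 < y) :
    perronKernelInt lam N c y = (smoothedStep lam N (-Real.log y) : ℂ) := by
  obtain ⟨n, rfl⟩ := Nat.exists_eq_succ_of_ne_zero hN.ne'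
  have hmellin : ∀ t : ℝ, mellin (fun t => (smoothedStep lam (n + 1) (Real.log t) : ℂ))
      ((c : ℂ) + t * I) =
      ((exp (lam * (c + t * I)) - 1) / (lam * (c + t * I))) ^ (n + 1) / ((c : ℂ) + t * I) :=
    fun t => (hasMellin_smoothedStep_log hlam (n + 1) (by simpa using hc)).2
  have hinv := mellinInv_mellin_eq c (fun t => (smoothedStep lam (n + 1) (Real.log t) : ℂ))
    (inv_pos.2 hy) (hasMellin_smoothedStep_log hlam (n + 1) (by simpa using hc)).1
    (by
      rw [VerticalIntegrable]
      simp_rw [hmellin]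
      exact integrable_smoothed_kernel hlam n hc)
    (continuous_ofReal.continuousAt.comp
      ((continuous_smoothedStep_succ hlam n).continuousAt.comp
        (Real.continuousAt_log (inv_pos.2 hy).ne')))
  rw [Real.log_inv] at hinv
  rw [Nat.succ_eq_add_one, ← hinv, mellinInv, perronKernelInt, ← smul_eq_mul]
  simp_rw [hmellin]
  rw [real_smul, smul_eq_mul]
  push_cast
  congr 2
  ext t
  rw [smul_eq_mul, mul_div_assoc, inv_cpow _ _ (by
    rw [arg_ofReal_of_nonneg hy.le]; exact Real.pi_pos.ne), cpow_neg, inv_inv]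

theorem stmt3 (lam : ℝ) (hlam : 0 < lam) (N : ℕ) (hN : 0 < N) (c : ℝ) (hc : 0 < c)
    (y : ℝ) (hy : 0 < y) :
    (1 ≤ y → perronKernelInt lam N c y = 1) ∧
    (Real.exp (-(lam * N)) ≤ y → y < 1 →
      ∃ x : ℝ, perronKernelInt lam N c y = (x : ℂ) ∧ 0 ≤ x ∧ x ≤ 1) ∧
    (y < Real.exp (-(lam * N)) → perronKernelInt lam N c y = 0) := by
  rw [perronKernelInt_eq_smoothedStep hlam hN hc hy]
  refine ⟨fun h => ?_, fun _ _ => ⟨_, rfl, smoothedStep_mem_Icc hlam N _⟩, fun h => ?_⟩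
  · rw [smoothedStep_of_nonpos hlam N (neg_nonpos.2 (Real.log_nonneg h)), ofReal_one]
  · rw [← Real.log_lt_iff_lt_exp hy] at h
    rw [smoothedStep_of_lt hlam N (by linarith), ofReal_zero]
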